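/- In R = A[[h]] (super-Jordanian deformation of sl(2|1)), define the h-deformed generators E₂ := e₂ - (h²/4)e₁e₃(2h₁+1), E₃ := e₃, F₂ := f₂, H₂ := h₂ - (h²/2)e₁²h₁. Then: T^{±1}E₂ - E₂T^{±1} = ±(h/2)(T^{±2}+1)E₃; E₂² = (h/4)(T - T⁻¹)E₃E₂; 2h(F₂E₃ + E₃F₂) = T - T⁻¹; E₂F₂ + F₂E₂ = H₂ - (1/16)(T - T⁻¹)² - (h/4)(T - T⁻¹)E₃F₂; and H₂E₃ - E₃H₂ = -(1/8)(T² + 6 + T⁻²)E₃. -/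

import Mathlib

noncomputable section

/-- The generalized binomial coefficient `α(α-1)⋯(α-n+1)/n!`. -/
def qbinom (α : ℚ) (n : ℕ) : ℚ :=
  (∏ i ∈ Finset.range n, (α - (i : ℚ))) / (n.factorial : ℚ)

/-- `S := Σ_{n≥0} binom(1/2,n) h^{2n} u^{2n}` in `A[[h]]`. -/
def sqrtSer {A : Type*} [Ring A] [Algebra ℂ A] (u : A) : PowerSeries A :=
  PowerSeries.mk fun m =>
    if m % 2 = 0 then ((qbinom (1/2) (m / 2) : ℚ) : ℂ) • u ^ m else 0

/-- `T := h·u + S`. -/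
def Tser {A : Type*} [Ring A] [Algebra ℂ A] (u : A) : PowerSeries A :=
  PowerSeries.X * PowerSeries.C u + sqrtSer u

/-- `T⁻¹ := -h·u + S`. -/
def Tinvser {A : Type*} [Ring A] [Algebra ℂ A] (u : A) : PowerSeries A :=
  -(PowerSeries.X * PowerSeries.C u) + sqrtSer u

lemma qbinom_eq_choose (α : ℚ) (n : ℕ) : qbinom α n = Ring.choose α n := by
  have h : (descPochhammer ℤ n).smeval α = ∏ i ∈ Finset.range n, (α - (i : ℚ)) := by
    rw [← Polynomial.aeval_eq_smeval]
    induction n with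
    | zero => simp
    | succ n ih => simp [descPochhammer_succ_right, Finset.prod_range_succ, ih]
  rw [Ring.choose_eq_smul, h, qbinom, smul_eq_mul, div_eq_inv_mul]

lemma coeff_sqrtSer {A : Type*} [Ring A] [Algebra ℂ A] (u : A) (n : ℕ) :
    PowerSeries.coeff n (sqrtSer u) =
      PowerSeries.coeff n (PowerSeries.expand 2 two_ne_zero
        (PowerSeries.binomialSeries ℂ (1 / 2 : ℚ))) • u ^ n := by
  rw [sqrtSer, PowerSeries.coeff_mk]
  split_ifs with h
  · obtain ⟨m, rfl⟩ := Nat.dvd_of_mod_eq_zero h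
    rw [PowerSeries.coeff_expand_mul, PowerSeries.binomialSeries_coeff, qbinom_eq_choose,
      Nat.mul_div_cancel_left m two_pos, Rat.smul_one_eq_cast]
  · rw [PowerSeries.coeff_expand_of_not_dvd _ _ _ (by omega), zero_smul]

lemma sqrtSer_mul_self {A : Type*} [Ring A] [Algebra ℂ A] (u : A) :
    sqrtSer u * sqrtSer u = 1 + PowerSeries.monomial 2 (u ^ 2) := by
  set p : PowerSeries ℂ := PowerSeries.expand 2 two_ne_zero
    (PowerSeries.binomialSeries ℂ (1 / 2 : ℚ)) with hp
  have hpp : p * p = 1 + PowerSeries.X ^ 2 := by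
    rw [hp, ← map_mul, ← PowerSeries.binomialSeries_add,
      show (1 / 2 + 1 / 2 : ℚ) = (1 : ℕ) by norm_num, PowerSeries.binomialSeries_nat]
    simp
  ext n
  have hn : PowerSeries.coeff n (sqrtSer u * sqrtSer u) =
      PowerSeries.coeff n (p * p) • u ^ n := by
    rw [PowerSeries.coeff_mul, PowerSeries.coeff_mul, Finset.sum_smul]
    refine Finset.sum_congr rfl fun ij hij => ?_
    rw [coeff_sqrtSer, coeff_sqrtSer, smul_mul_smul_comm, ← pow_add,
      Finset.HasAntidiagonal.mem_antidiagonal.1 hij]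
  rw [hn, hpp, map_add, map_add, add_smul, PowerSeries.coeff_one, PowerSeries.coeff_one,
    PowerSeries.coeff_X_pow, PowerSeries.coeff_monomial]
  congr 1 <;> split_ifs with h <;> simp [h]

lemma coeff_zero_sqrtSer {A : Type*} [Ring A] [Algebra ℂ A] (u : A) :
    PowerSeries.coeff 0 (sqrtSer u) = 1 := by
  simp [sqrtSer, qbinom]

lemma commute_sqrtSer_C {A : Type*} [Ring A] [Algebra ℂ A] {u a : A} (h : Commute u a) :
    Commute (sqrtSer u) (PowerSeries.C a) := by
  ext n
  rw [PowerSeries.coeff_mul_C, PowerSeries.coeff_C_mul, coeff_sqrtSer, smul_mul_assoc,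
    mul_smul_comm, (h.pow_left n).eq]

lemma eq_zero_of_mul_add_mul_eq_zero {A : Type*} [Ring A] [Algebra ℂ A] {s z : PowerSeries A}
    (hs : PowerSeries.coeff 0 s = 1) (h : s * z + z * s = 0) : z = 0 := by
  ext n
  induction n using Nat.strong_induction_on with
  | _ n ih =>
    have hn := congrArg (PowerSeries.coeff n) h
    rw [map_add, PowerSeries.coeff_mul, PowerSeries.coeff_mul,
      Finset.sum_eq_single (0, n), Finset.sum_eq_single (n, 0), hs, one_mul, mul_one,
      ← two_smul ℂ, map_zero] at hn
    · simpa using hn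
    · rintro ⟨i, j⟩ hij hne
      have hij := Finset.HasAntidiagonal.mem_antidiagonal.1 hij
      rw [ih i (by grind), map_zero, zero_mul]
    · simp
    · rintro ⟨i, j⟩ hij hne
      have hij := Finset.HasAntidiagonal.mem_antidiagonal.1 hij
      rw [ih j (by grind), map_zero, mul_zero]
    · simp

/-- If `s ^ 2 = 1 + y ^ 2` and `[y, E] = x s² z`, where `x` is central and `s, y, z` commute,
then `[s, E]` is determined. -/
lemma commutator_sqrt {A : Type*} [Ring A] [Algebra ℂ A] {s x y z E : PowerSeries A}
    (hs : PowerSeries.coeff 0 s = 1) (hss : s * s = 1 + y * y)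
    (hx : ∀ a, Commute x a) (hsy : Commute s y) (hsz : Commute s z) (hyz : Commute y z)
    (hy : y * E - E * y = x * (s * s * z)) :
    s * E - E * s = x * (y * s * z) := by
  rw [← sub_eq_zero]
  apply eq_zero_of_mul_add_mul_eq_zero hs
  have h₁ : s * (s * E - E * s) + (s * E - E * s) * s =
      y * (y * E - E * y) + (y * E - E * y) * y := by
    linear_combination (norm := noncomm_ring) hss * E - E * hss
  have h₂ : y * (x * (s * s * z)) = x * (y * s * s * z) := by
    rw [← mul_assoc, ← (hx y).eq]; noncomm_ring
  have h₃ : x * (s * s * z) * y = x * (y * s * s * z) := by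
    simp only [mul_assoc]
    rw [← hyz.eq, hsy.left_comm, hsy.left_comm]
  have h₄ : s * (x * (y * s * z)) = x * (y * s * s * z) := by
    rw [← mul_assoc, ← (hx s).eq]
    simp only [mul_assoc]
    rw [hsy.left_comm]
  have h₅ : x * (y * s * z) * s = x * (y * s * s * z) := by
    simp only [mul_assoc]
    rw [← hsz.eq]
  rw [hy, h₂, h₃] at h₁
  linear_combination (norm := noncomm_ring) h₁ - h₄ - h₅

/-- In `R = A[[h]]` (super-Jordanian deformation of `sl(2|1)`), with `e₃ := e₁e₂-e₂e₁`,
`S`, `T`, `T⁻¹` as above (for `u = e₁`), and the `h`-deformed generators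
`E₂ := e₂ - (h²/4)e₁e₃(2h₁+1)`, `E₃ := e₃`, `F₂ := f₂`, `H₂ := h₂ - (h²/2)e₁²h₁`,
the listed super-Jordanian `U_h(sl(2|1))` relations hold.  Here `A` is any unital
associative `ℂ`-algebra containing elements `h₁, h₂, e₁, e₂, f₁, f₂` with the
`sl(2|1)` relations (`e₂, f₂` odd, the rest even). -/
theorem statement_19 (A : Type*) [Ring A] [Algebra ℂ A] (h₁ h₂ e₁ e₂ f₁ f₂ : A)
    (r1 : h₁ * h₂ - h₂ * h₁ = 0)
    (r2 : h₁ * e₁ - e₁ * h₁ = 2 * e₁)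
    (r3 : h₁ * f₁ - f₁ * h₁ = -(2 * f₁))
    (r4 : h₁ * e₂ - e₂ * h₁ = -e₂)
    (r5 : h₁ * f₂ - f₂ * h₁ = f₂)
    (r6 : h₂ * e₁ - e₁ * h₂ = -e₁)
    (r7 : h₂ * f₁ - f₁ * h₂ = f₁)
    (r8 : h₂ * e₂ - e₂ * h₂ = 0)
    (r9 : h₂ * f₂ - f₂ * h₂ = 0)
    (r10 : e₁ * f₁ - f₁ * e₁ = h₁)
    (r11 : e₂ * f₂ + f₂ * e₂ = h₂)
    (r12 : e₁ * f₂ - f₂ * e₁ = 0)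
    (r13 : e₂ * f₁ - f₁ * e₂ = 0)
    (r14 : e₂ ^ 2 = 0)
    (r15 : f₂ ^ 2 = 0)
    (r16 : e₁ ^ 2 * e₂ - 2 * (e₁ * e₂ * e₁) + e₂ * e₁ ^ 2 = 0)
    (r17 : f₁ ^ 2 * f₂ - 2 * (f₁ * f₂ * f₁) + f₂ * f₁ ^ 2 = 0) :
    ∀ T Tinv E₂' E₃' F₂' H₂' : PowerSeries A,
      T = Tser e₁ →
      Tinv = Tinvser e₁ →
      E₂' = PowerSeries.C e₂ -
        (1/4 : ℂ) • (PowerSeries.X ^ 2 *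
          PowerSeries.C (e₁ * (e₁ * e₂ - e₂ * e₁) * (2 * h₁ + 1))) →
      E₃' = PowerSeries.C (e₁ * e₂ - e₂ * e₁) →
      F₂' = PowerSeries.C f₂ →
      H₂' = PowerSeries.C h₂ -
        (1/2 : ℂ) • (PowerSeries.X ^ 2 * PowerSeries.C (e₁ ^ 2 * h₁)) →
      (T * E₂' - E₂' * T = (1/2 : ℂ) • (PowerSeries.X * ((T ^ 2 + 1) * E₃')) ∧
       Tinv * E₂' - E₂' * Tinv =
         -((1/2 : ℂ) • (PowerSeries.X * ((Tinv ^ 2 + 1) * E₃'))) ∧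
       E₂' ^ 2 = (1/4 : ℂ) • (PowerSeries.X * ((T - Tinv) * (E₃' * E₂'))) ∧
       (2 : ℂ) • (PowerSeries.X * (F₂' * E₃' + E₃' * F₂')) = T - Tinv ∧
       E₂' * F₂' + F₂' * E₂' =
         H₂' - (1/16 : ℂ) • (T - Tinv) ^ 2 -
           (1/4 : ℂ) • (PowerSeries.X * ((T - Tinv) * (E₃' * F₂'))) ∧
       H₂' * E₃' - E₃' * H₂' =
         -((1/8 : ℂ) • ((T ^ 2 + 6 + Tinv ^ 2) * E₃'))) := by
  rintro T Tinv E₂' E₃' F₂' H₂' rfl rfl rfl rfl rfl rfl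
  obtain ⟨e₃, he₃⟩ : ∃ e₃, e₃ = e₁ * e₂ - e₂ * e₁ := ⟨_, rfl⟩
  have c₁₃ : e₁ * e₃ = e₃ * e₁ := by
    rw [he₃]; linear_combination (norm := noncomm_ring) r16
  have c₂₃ : e₂ * e₃ = -(e₃ * e₂) := by
    rw [he₃]; linear_combination (norm := noncomm_ring) e₁ * r14 - r14 * e₁
  have c₃₃ : e₃ * e₃ = 0 := by
    have h : (2 : ℂ) • (e₃ * e₃) = 0 := by
      rw [two_smul]
      linear_combination (norm := noncomm_ring)
        e₃ * he₃ + he₃ * e₃ + e₁ * c₂₃ - e₂ * c₁₃ - c₂₃ * e₁ - c₁₃ * e₂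
    simpa using h
  have ch₃ : h₁ * e₃ = e₃ * h₁ + e₃ := by
    rw [he₃]
    linear_combination (norm := noncomm_ring) r2 * e₂ + e₁ * r4 - r4 * e₁ - e₂ * r2
  have ch₂₃ : h₂ * e₃ = e₃ * h₂ - e₃ := by
    rw [he₃]
    linear_combination (norm := noncomm_ring) r6 * e₂ + e₁ * r8 - r8 * e₁ - e₂ * r6
  have cf₃ : f₂ * e₃ = e₁ - e₃ * f₂ := by
    rw [he₃]
    linear_combination (norm := noncomm_ring)
      e₁ * r11 - r11 * e₁ - e₂ * r12 - r12 * e₂ - r6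
  rw [← he₃]
  obtain ⟨w, hw⟩ : ∃ w, w = e₁ * e₃ * (2 * h₁ + 1) := ⟨_, rfl⟩
  have w₁ : e₁ * w - w * e₁ = -(4 • (e₁ * (e₁ * e₃))) := by
    rw [hw]
    linear_combination (norm := noncomm_ring)
      e₁ * c₁₃ * (2 * h₁ + 1) - 2 * e₁ * e₃ * r2 + 4 * e₁ * c₁₃
  have w₂ : e₂ * w + w * e₂ = -(2 • (e₁ * (e₃ * e₂))) := by
    rw [hw]
    linear_combination (norm := noncomm_ring)
      he₃ * e₃ * (2 * h₁ + 1) + e₁ * c₂₃ * (2 * h₁ + 1) + 2 * e₁ * e₃ * r4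
        - c₃₃ * (2 * h₁ + 1)
  have wf : w * f₂ + f₂ * w = 2 • (e₁ * (e₁ * h₁)) + e₁ * e₁ + 2 • (e₁ * (e₃ * f₂)) := by
    rw [hw]
    linear_combination (norm := noncomm_ring)
      2 * e₁ * e₃ * r5 - r12 * e₃ * (2 * h₁ + 1) + e₁ * cf₃ * (2 * h₁ + 1)
  have ww : w * w = 0 := by
    rw [hw]
    linear_combination (norm := noncomm_ring)
      2 * e₁ * e₃ * r2 * e₃ * (2 * h₁ + 1) + 2 * e₁ * e₃ * e₁ * ch₃ * (2 * h₁ + 1)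
      - e₁ * c₁₃ * e₃ * (2 * h₁ + 7) * (2 * h₁ + 1) + e₁ * e₁ * c₃₃ * (2 * h₁ + 7) * (2 * h₁ + 1)
  have w₃ : e₃ * w = 0 := by
    rw [hw]
    linear_combination (norm := noncomm_ring)
      e₁ * c₃₃ * (2 * h₁ + 1) - c₁₃ * e₃ * (2 * h₁ + 1)
  have hh₃ : e₁ * (e₁ * (h₁ * e₃)) - e₃ * (e₁ * (e₁ * h₁)) = e₁ * (e₁ * e₃) := by
    linear_combination (norm := noncomm_ring) e₁ * e₁ * ch₃ + e₁ * c₁₃ * h₁ + c₁₃ * e₁ * h₁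
  have hm : ∀ {a b : A} (k : ℕ), a = b → PowerSeries.monomial k a = PowerSeries.monomial k b :=
    fun k h => congrArg _ h
  have hX : (PowerSeries.X : PowerSeries A) = PowerSeries.monomial 1 1 := PowerSeries.X_eq
  have hX2 : (PowerSeries.X : PowerSeries A) ^ 2 = PowerSeries.monomial 2 1 :=
    PowerSeries.X_pow_eq 2
  have hC : ∀ a : A, PowerSeries.C a = PowerSeries.monomial 0 a :=
    fun a => (PowerSeries.monomial_zero_eq_C_apply a).symm
  have hx : ∀ a : PowerSeries A, Commute PowerSeries.X a :=
    fun a => (PowerSeries.commute_X a).symm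
  have hTT : Tser e₁ - Tinvser e₁ = PowerSeries.monomial 1 (2 • e₁) := by
    rw [Tser, Tinvser, hX, hC, PowerSeries.monomial_mul_monomial, two_nsmul, map_add, one_mul]
    abel
  set s := sqrtSer e₁ with hs
  rw [← hw]
  set E := PowerSeries.C e₂ - (1 / 4 : ℂ) • (PowerSeries.X ^ 2 * PowerSeries.C w) with hE
  set y := PowerSeries.X * PowerSeries.C e₁ with hy
  have hss : s * s = 1 + y * y := by
    rw [hs, sqrtSer_mul_self, hy, hX, hC, PowerSeries.monomial_mul_monomial,
      PowerSeries.monomial_mul_monomial, one_mul, sq]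
  have hyE : y * E - E * y = PowerSeries.X * (s * s * PowerSeries.C e₃) := by
    have m₁ := hm 1 he₃
    have m₂ := hm 3 w₁
    rw [hss, hE, hy, hX2, hX]
    simp only [hC, mul_sub, sub_mul, mul_add, add_mul, PowerSeries.monomial_mul_monomial,
      smul_mul_assoc, mul_smul_comm, one_mul, mul_assoc, map_nsmul,
      map_sub, map_neg, add_zero, zero_add, Nat.reduceAdd] at m₁ m₂ ⊢
    linear_combination (norm := module) -m₁ - (1 / 4 : ℂ) • m₂
  have hsy : Commute s y :=
    ((hx s).symm).mul_right (commute_sqrtSer_C (Commute.refl e₁))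
  have hsz : Commute s (PowerSeries.C e₃) := commute_sqrtSer_C c₁₃
  have hyz : Commute y (PowerSeries.C e₃) :=
    (hx _).mul_left (Commute.map c₁₃ (PowerSeries.C (R := A)))
  have hT : Tser e₁ = y + s := rfl
  have hT' : Tinvser e₁ = -y + s := rfl
  have hsE : s * E - E * s = PowerSeries.X * (y * s * PowerSeries.C e₃) :=
    commutator_sqrt (coeff_zero_sqrtSer e₁) hss hx hsy hsz hyz hyE
  refine ⟨?_, ?_, ?_, ?_, ?_, ?_⟩
  · have h : (y + s) ^ 2 + 1 = (2 : ℂ) • (s * s + y * s) := by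
      rw [two_smul]
      linear_combination (norm := noncomm_ring) hsy.eq - hss
    rw [hT, h, smul_mul_assoc, mul_smul_comm, smul_smul]
    norm_num
    linear_combination (norm := noncomm_ring) hyE + hsE
  · have h : (-y + s) ^ 2 + 1 = (2 : ℂ) • (s * s - y * s) := by
      rw [two_smul]
      linear_combination (norm := noncomm_ring) -hsy.eq - hss
    rw [hT', h, smul_mul_assoc, mul_smul_comm, smul_smul]
    norm_num
    linear_combination (norm := noncomm_ring) hsE - hyE
  · have m₁ := hm 0 r14
    have m₂ := hm 2 w₂
    have m₃ := hm 4 ww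
    have m₄ := hm 4 ((congrArg (e₁ * ·) w₃).trans (mul_zero e₁))
    rw [hTT, hE, hX2, hX]
    simp only [hC, sq, mul_sub, sub_mul, PowerSeries.monomial_mul_monomial,
      smul_mul_assoc, mul_smul_comm, one_mul, map_nsmul, map_zero, map_add,
      map_neg, add_zero, zero_add, Nat.reduceAdd] at m₁ m₂ m₃ m₄ ⊢
    linear_combination (norm := module) m₁ - (1 / 4 : ℂ) • m₂ + (1 / 16 : ℂ) • m₃ + (1 / 8 : ℂ) • m₄
  · have m₁ := hm 1 cf₃
    rw [hTT, hX]
    simp only [hC, mul_add, PowerSeries.monomial_mul_monomial,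
      one_mul, map_nsmul,
      map_sub, add_zero] at m₁ ⊢
    linear_combination (norm := module) (2 : ℂ) • m₁
  · have m₁ := hm 0 r11
    have m₂ := hm 2 wf
    rw [hTT, hE, hX2, hX]
    simp only [hC, sq, mul_sub, sub_mul, PowerSeries.monomial_mul_monomial,
      smul_mul_assoc, mul_smul_comm, one_mul, mul_assoc, map_nsmul, map_add,
      add_zero, zero_add, Nat.reduceAdd] at m₁ m₂ ⊢
    linear_combination (norm := module) m₁ - (1 / 4 : ℂ) • m₂
  · have h : Tser e₁ ^ 2 + 6 + Tinvser e₁ ^ 2 = (8 : ℂ) • 1 + (4 : ℂ) • (y * y) := by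
      have h₁ : Tser e₁ ^ 2 + 6 + Tinvser e₁ ^ 2 = 8 • 1 + 4 • (y * y) := by
        have h₆ : (6 : PowerSeries A) = 6 • 1 := by norm_num
        rw [hT, hT']
        linear_combination (norm := noncomm_ring) 2 * hss + h₆
      rw [h₁]
      module
    have m₁ := hm 0 ch₂₃
    have m₂ := hm 2 hh₃
    rw [h, hy, hX2, hX]
    simp only [hC, sq, mul_sub, sub_mul, add_mul, PowerSeries.monomial_mul_monomial,
      smul_mul_assoc, mul_smul_comm, one_mul, mul_assoc,
      map_sub, add_zero, zero_add, Nat.reduceAdd] at m₁ m₂ ⊢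
    linear_combination (norm := module) m₁ - (1 / 2 : ℂ) • m₂
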